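/- arXiv:2202.05466 — 4 statements merged into one kernel-verified Lean document; each statement's English description precedes it below -/
import Mathlib

section
/- Let U ⊆ ℝ² be open and let f : ℝ² → ℝ be twice continuously differentiable on U with f(x,t) ≠ 0 for all (x,t) ∈ U. Suppose f satisfies the generalized bilinear KdV-type equation 2 f_{xt} f − 2 f_t f_x + 6 (f_{xx})² = 0 on U, where subscripts denote partial derivatives in the first variable x and the second variable t. Then the function u := 2 f_x / f satisfies the KdV-like equation u_t + (3/2)(u_x)² + (3/2) u² u_x + (3/8) u⁴ = 0 at every point of U. -/
/-- Partial derivative in the first (spatial) variable `x`. -/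
noncomputable def px (f : ℝ → ℝ → ℝ) : ℝ → ℝ → ℝ :=
  fun x t => deriv (fun y => f y t) x

/-- Partial derivative in the second (time) variable `t`. -/
noncomputable def pt (f : ℝ → ℝ → ℝ) : ℝ → ℝ → ℝ :=
  fun x t => deriv (fun s => f x s) t

theorem hasDerivAt_px {g : ℝ → ℝ → ℝ} {p : ℝ × ℝ}
    (hg : DifferentiableAt ℝ (fun q : ℝ × ℝ => g q.1 q.2) p) :
    HasDerivAt (fun y => g y p.2) (px g p.1 p.2) p.1 := by
  have h : DifferentiableAt ℝ (fun y : ℝ => (y, p.2)) p.1 := by fun_prop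
  exact (DifferentiableAt.comp p.1 (g := fun q : ℝ × ℝ => g q.1 q.2) hg h).hasDerivAt

theorem hasDerivAt_pt {g : ℝ → ℝ → ℝ} {p : ℝ × ℝ}
    (hg : DifferentiableAt ℝ (fun q : ℝ × ℝ => g q.1 q.2) p) :
    HasDerivAt (fun s => g p.1 s) (pt g p.1 p.2) p.2 := by
  have h : DifferentiableAt ℝ (fun s : ℝ => (p.1, s)) p.2 := by fun_prop
  exact (DifferentiableAt.comp p.2 (g := fun q : ℝ × ℝ => g q.1 q.2) hg h).hasDerivAt

theorem px_eq_fderiv {g : ℝ → ℝ → ℝ} {p : ℝ × ℝ}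
    (hg : DifferentiableAt ℝ (fun q : ℝ × ℝ => g q.1 q.2) p) :
    px g p.1 p.2 = fderiv ℝ (fun q : ℝ × ℝ => g q.1 q.2) p (1, 0) := by
  have h : HasDerivAt (fun y : ℝ => (y, p.2)) (1, 0) p.1 :=
    (hasDerivAt_id p.1).prodMk (hasDerivAt_const p.1 p.2)
  exact (HasFDerivAt.comp_hasDerivAt (l := fun q : ℝ × ℝ => g q.1 q.2) p.1
    hg.hasFDerivAt h).deriv

theorem differentiableAt_px {g : ℝ → ℝ → ℝ} {p : ℝ × ℝ}
    (hg : ContDiffAt ℝ 2 (fun q : ℝ × ℝ => g q.1 q.2) p) :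
    DifferentiableAt ℝ (fun q : ℝ × ℝ => px g q.1 q.2) p := by
  have h : DifferentiableAt ℝ (fderiv ℝ (fun q : ℝ × ℝ => g q.1 q.2)) p :=
    (hg.fderiv_right (m := 1) (by norm_num)).differentiableAt (by norm_num)
  refine (h.clm_apply (differentiableAt_const ((1, 0) : ℝ × ℝ))).congr_of_eventuallyEq ?_
  filter_upwards [hg.eventually (by simp)] with q hq
  exact px_eq_fderiv (hq.differentiableAt (by norm_num))

/-- If `f` is C² on an open set `U`, nonvanishing on `U`, and satisfies the generalized
bilinear KdV-type equation `2 f_{xt} f − 2 f_t f_x + 6 (f_{xx})² = 0` on `U`, then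
`u = 2 f_x / f` satisfies `u_t + (3/2) u_x² + (3/2) u² u_x + (3/8) u⁴ = 0` on `U`. -/
theorem rational_solution_KdV_like (U : Set (ℝ × ℝ)) (hU : IsOpen U) (f : ℝ → ℝ → ℝ)
    (hf : ContDiffOn ℝ 2 (fun p : ℝ × ℝ => f p.1 p.2) U)
    (hne : ∀ p ∈ U, f p.1 p.2 ≠ 0)
    (heq : ∀ p ∈ U,
      2 * pt (px f) p.1 p.2 * f p.1 p.2 - 2 * pt f p.1 p.2 * px f p.1 p.2
        + 6 * (px (px f) p.1 p.2) ^ 2 = 0) :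
    ∀ p ∈ U,
      pt (fun x t => 2 * px f x t / f x t) p.1 p.2
        + (3 / 2) * (px (fun x t => 2 * px f x t / f x t) p.1 p.2) ^ 2
        + (3 / 2) * (2 * px f p.1 p.2 / f p.1 p.2) ^ 2
            * px (fun x t => 2 * px f x t / f x t) p.1 p.2
        + (3 / 8) * (2 * px f p.1 p.2 / f p.1 p.2) ^ 4 = 0 := by
  intro p hp
  have hC := hf.contDiffAt (hU.mem_nhds hp)
  have hd := hC.differentiableAt (by norm_num)
  have hdx := differentiableAt_px hC
  have h0 := hne p hp
  have ht : pt (fun x t => 2 * px f x t / f x t) p.1 p.2 = _ :=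
    (((hasDerivAt_pt hdx).const_mul 2).div (hasDerivAt_pt hd) h0).deriv
  have hx : px (fun x t => 2 * px f x t / f x t) p.1 p.2 = _ :=
    (((hasDerivAt_px hdx).const_mul 2).div (hasDerivAt_px hd) h0).deriv
  rw [ht, hx]
  have h := heq p hp
  field_simp
  linear_combination 8 * f p.1 p.2 ^ 2 * h
end

section
/- Let m ≥ 1 and let f = Σ_{j=0}^{m} f_j(t) x^j ∈ ℂ[x,t] with f_m ≠ 0 (so deg_x f = m). Suppose B_(m) f = 0, i.e., the coefficient of x^p in Tf vanishes for every p ≥ m − 1. Then the leading coefficient f_m divides every coefficient in ℂ[t]: for each 0 ≤ k ≤ m there exists P_k ∈ ℂ[t] with f_k = P_k·f_m. -/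
open Polynomial

/-- Formal partial derivative with respect to `t` on `ℂ[t][x]`
(outer variable `x`, inner variable `t`). -/
noncomputable def dt (f : Polynomial (Polynomial ℂ)) : Polynomial (Polynomial ℂ) :=
  f.sum fun n a => Polynomial.C (Polynomial.derivative a) * Polynomial.X ^ n

/-- Formal partial derivative with respect to `x` on `ℂ[t][x]`. -/
noncomputable def dx (f : Polynomial (Polynomial ℂ)) : Polynomial (Polynomial ℂ) :=
  Polynomial.derivative f

/-- The operator `T f = 2 f_{xt} f − 2 f_t f_x + 6 (f_{xx})²`; the generalized bilinear
KdV-type equation is `T f = 0`. -/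
noncomputable def Tkdv (f : Polynomial (Polynomial ℂ)) : Polynomial (Polynomial ℂ) :=
  2 * dx (dt f) * f - 2 * dt f * dx f + 6 * (dx (dx f)) ^ 2

/-- `B_(m) f = 0`: the coefficient of `x^p` in `T f` vanishes for every `p ≥ m − 1`
(equivalently `deg_x (T f) ≤ m − 2`). -/
def Bzero (m : ℕ) (f : Polynomial (Polynomial ℂ)) : Prop :=
  ∀ p : ℕ, m - 1 ≤ p → (Tkdv f).coeff p = 0

/-- Over a field of characteristic zero, a vanishing Wronskian forces proportionality. -/
theorem Polynomial.exists_eq_C_mul_of_wronskian_eq_zero {a g : ℂ[X]} (ha : a ≠ 0)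
    (h : wronskian a g = 0) : ∃ c : ℂ, g = C c * a := by
  obtain ⟨d, hd⟩ : ∃ d, d = EuclideanDomain.gcd a g := ⟨_, rfl⟩
  have hd0 : d ≠ 0 := fun h0 => ha (EuclideanDomain.gcd_eq_zero_iff.1 (hd ▸ h0)).1
  obtain ⟨p, hp⟩ : d ∣ a := hd ▸ EuclideanDomain.gcd_dvd_left a g
  obtain ⟨q, hq⟩ : d ∣ g := hd ▸ EuclideanDomain.gcd_dvd_right a g
  have hcop : IsCoprime p q := by
    refine ⟨EuclideanDomain.gcdA a g, EuclideanDomain.gcdB a g, mul_left_cancel₀ hd0 ?_⟩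
    have := EuclideanDomain.gcd_eq_gcd_ab a g
    rw [← hd] at this
    linear_combination -this - EuclideanDomain.gcdA a g * hp - EuclideanDomain.gcdB a g * hq
  have hw : wronskian p q = 0 := by
    have : d ^ 2 * wronskian p q = 0 := by
      rw [← h, hp, hq]
      simp only [wronskian, derivative_mul]
      ring
    exact (mul_eq_zero.1 this).resolve_left (pow_ne_zero 2 hd0)
  obtain ⟨hp', hq'⟩ := hcop.wronskian_eq_zero_iff.1 hw
  rw [eq_C_of_derivative_eq_zero hp'] at hp
  rw [eq_C_of_derivative_eq_zero hq'] at hq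
  have hp0 : p.coeff 0 ≠ 0 := by
    intro h0
    simp [h0] at hp
    exact ha hp
  refine ⟨q.coeff 0 / p.coeff 0, ?_⟩
  have : C (q.coeff 0 / p.coeff 0) * C (p.coeff 0) = C (q.coeff 0) := by
    rw [← C_mul, div_mul_cancel₀ _ hp0]
  rw [hq, hp, ← this]
  ring

/-- Every complex polynomial has a polynomial antiderivative. -/
theorem Polynomial.exists_derivative_eq (q : ℂ[X]) : ∃ r : ℂ[X], derivative r = q := by
  induction q using Polynomial.induction_on' with
  | add p q hp hq =>
    obtain ⟨r, rfl⟩ := hp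
    obtain ⟨s, rfl⟩ := hq
    exact ⟨r + s, derivative_add⟩
  | monomial n c =>
    refine ⟨monomial (n + 1) (c / (n + 1)), ?_⟩
    have : (n : ℂ) + 1 ≠ 0 := by exact_mod_cast n.succ_ne_zero
    rw [derivative_monomial]
    simp [this]

/-- If `a ^ 2` divides the Wronskian of `a` and `g`, then `g / a` has polynomial derivative,
so `a` divides `g`. -/
theorem Polynomial.dvd_of_sq_dvd_wronskian {a g : ℂ[X]} (ha : a ≠ 0)
    (h : a ^ 2 ∣ wronskian a g) : a ∣ g := by
  obtain ⟨q, hq⟩ := h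
  obtain ⟨r, rfl⟩ := exists_derivative_eq q
  have hw : wronskian a (g - r * a) = 0 := by
    simp only [wronskian, derivative_mul, derivative_sub] at hq ⊢
    linear_combination hq
  obtain ⟨c, hc⟩ := exists_eq_C_mul_of_wronskian_eq_zero ha hw
  exact ⟨r + C c, by linear_combination hc⟩

theorem Polynomial.sq_dvd_wronskian {a g h : ℂ[X]} (hg : a ∣ g) (hh : a ∣ h) :
    a ^ 2 ∣ wronskian g h := by
  obtain ⟨p, rfl⟩ := hg
  obtain ⟨q, rfl⟩ := hh
  refine ⟨wronskian p q, ?_⟩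
  simp only [wronskian, derivative_mul]
  ring

theorem coeff_dt (f : ℂ[X][X]) (n : ℕ) : (dt f).coeff n = derivative (f.coeff n) := by
  rw [dt, Polynomial.sum, finsetSum_coeff]
  simp only [coeff_C_mul_X_pow]
  rw [Finset.sum_ite_eq]
  split_ifs with h
  · rfl
  · rw [notMem_support_iff.1 h, derivative_zero]

theorem coeff_X_mul_dx (f : ℂ[X][X]) (n : ℕ) : (X * dx f).coeff n = n * f.coeff n := by
  cases n with
  | zero => simp
  | succ n =>
    rw [coeff_X_mul, dx, coeff_derivative]
    push_cast
    ring

/-- The bilinear part of `Tkdv`, expressed through Wronskians of the coefficients. -/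
theorem coeff_hirota (f : ℂ[X][X]) (n : ℕ) :
    (2 * dx (dt f) * f - 2 * dt f * dx f).coeff n =
      ∑ i ∈ Finset.HasAntidiagonal.antidiagonal (n + 1),
        ((i.2 : ℂ[X]) - i.1) * wronskian (f.coeff i.1) (f.coeff i.2) := by
  have hX : X * (2 * dx (dt f) * f - 2 * dt f * dx f) =
      (X * dx (dt f) * f - dt f * (X * dx f)) + (f * (X * dx (dt f)) - X * dx f * dt f) := by
    ring
  rw [← coeff_X_mul, hX]
  simp only [coeff_add, coeff_sub, coeff_mul _ _ (n + 1), coeff_X_mul_dx, coeff_dt]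
  rw [← Finset.sum_sub_distrib, ← Finset.sum_sub_distrib, ← Finset.sum_add_distrib]
  refine Finset.sum_congr rfl fun i _ => ?_
  rw [wronskian]
  ring

theorem sq_dvd_coeff_dx_dx_sq {f : ℂ[X][X]} {a : ℂ[X]} {m l : ℕ}
    (hdeg : f.natDegree ≤ m) (ha : ∀ k, l < k → a ∣ f.coeff k) :
    a ^ 2 ∣ ((dx (dx f)) ^ 2).coeff (m + l - 1) := by
  rw [sq, sq, coeff_mul]
  refine Finset.dvd_sum fun i hi => ?_
  rw [Finset.HasAntidiagonal.mem_antidiagonal] at hi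
  simp only [dx, coeff_derivative]
  by_cases h1 : m < i.1 + 1 + 1
  · simp [coeff_eq_zero_of_natDegree_lt (hdeg.trans_lt h1)]
  by_cases h2 : m < i.2 + 1 + 1
  · simp [coeff_eq_zero_of_natDegree_lt (hdeg.trans_lt h2)]
  exact mul_dvd_mul (((ha _ (by omega)).mul_right _).mul_right _)
    (((ha _ (by omega)).mul_right _).mul_right _)

/-- One step of the descent: if `f_m` divides all coefficients above `x ^ l`, it divides `f_l`. -/
theorem leading_coeff_dvd_coeff_of_forall_gt {m l : ℕ} {f : ℂ[X][X]} (hl : l < m)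
    (hdeg : f.natDegree ≤ m) (hfm : f.coeff m ≠ 0) (hB : Bzero m f)
    (ih : ∀ k, l < k → f.coeff m ∣ f.coeff k) : f.coeff m ∣ f.coeff l := by
  refine dvd_of_sq_dvd_wronskian hfm ?_
  have h0 := hB (m + l - 1) (by omega)
  have hsq := sq_dvd_coeff_dx_dx_sq hdeg ih
  rw [Tkdv, coeff_add, coeff_hirota, show m + l - 1 + 1 = m + l by omega,
    show (6 : ℂ[X][X]) = C 6 from rfl, coeff_C_mul] at h0
  have hml : (m, l) ∈ Finset.HasAntidiagonal.antidiagonal (m + l) := by simp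
  have hlm : (l, m) ∈ (Finset.HasAntidiagonal.antidiagonal (m + l)).erase (m, l) := by
    simp [hl.ne, add_comm]
  have hrest : f.coeff m ^ 2 ∣ ∑ i ∈ ((Finset.HasAntidiagonal.antidiagonal (m + l)).erase (m, l)).erase (l, m),
      ((i.2 : ℂ[X]) - i.1) * wronskian (f.coeff i.1) (f.coeff i.2) := by
    refine Finset.dvd_sum fun i hi => ?_
    obtain ⟨j, k⟩ := i
    simp only [Finset.mem_erase, Finset.HasAntidiagonal.mem_antidiagonal, ne_eq, Prod.mk.injEq] at hi
    obtain ⟨h1, h2, h3⟩ := hi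
    refine Dvd.dvd.mul_left ?_ _
    by_cases hj : m < j
    · simp [wronskian, coeff_eq_zero_of_natDegree_lt (hdeg.trans_lt hj)]
    by_cases hk : m < k
    · simp [wronskian, coeff_eq_zero_of_natDegree_lt (hdeg.trans_lt hk)]
    exact sq_dvd_wronskian (ih j (by omega)) (ih k (by omega))
  rw [← Finset.add_sum_erase _ _ hml, ← Finset.add_sum_erase _ _ hlm] at h0
  have hunit : IsUnit (2 * ((m : ℂ[X]) - l)) := by
    have hc : (2 * ((m : ℂ) - l)) ≠ 0 :=
      mul_ne_zero two_ne_zero (sub_ne_zero.2 (by exact_mod_cast hl.ne'))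
    have h2 := isUnit_C.2 hc.isUnit
    rwa [C_mul, C_sub, C_ofNat, C_eq_natCast, C_eq_natCast] at h2
  refine (hunit.dvd_mul_left).1 ?_
  convert dvd_add hrest (hsq.mul_left 6) using 1
  have hneg : wronskian (f.coeff l) (f.coeff m) = -wronskian (f.coeff m) (f.coeff l) := by
    simp only [wronskian]
    ring
  rw [hneg] at h0
  linear_combination -h0

/-- If `f = Σ_{j=0}^m f_j(t) x^j` with `f_m ≠ 0` satisfies `B_(m) f = 0`, then the leading
coefficient `f_m` divides every coefficient: each `f_k = P_k · f_m` for some `P_k ∈ ℂ[t]`. -/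
theorem leading_coeff_divides (m : ℕ) (hm : 1 ≤ m) (f : Polynomial (Polynomial ℂ))
    (hdeg : f.natDegree ≤ m) (hfm : f.coeff m ≠ 0) (hB : Bzero m f) :
    ∀ k : ℕ, k ≤ m → ∃ P : Polynomial ℂ, f.coeff k = P * f.coeff m := by
  intro k _
  have key : ∀ n k, m - k ≤ n → f.coeff m ∣ f.coeff k := by
    intro n
    induction n with
    | zero =>
      intro k hk
      rcases (Nat.sub_eq_zero_iff_le.1 (Nat.le_zero.1 hk)).eq_or_lt with rfl | h
      · exact dvd_rfl
      · simp [coeff_eq_zero_of_natDegree_lt (hdeg.trans_lt h)]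
    | succ n ih =>
      intro k hk
      by_cases h : k < m
      · exact leading_coeff_dvd_coeff_of_forall_gt h hdeg hfm hB fun j hj => ih j (by omega)
      · exact ih k (by omega)
  exact exists_eq_mul_left_of_dvd (key _ k le_rfl)
end

section
/- Let c₀, c₂ ∈ ℝ and define u(x,t) = 2(9x² + 6c₂x + c₂²)/(3x³ + 3c₂x² + c₂²x + 108t + 3c₀) on the open set D = {(x,t) ∈ ℝ² : 3x³ + 3c₂x² + c₂²x + 108t + 3c₀ ≠ 0}. Then u is a rational solution of the KdV-like equation: at every point of D, u_t + (3/2)(u_x)² + (3/2) u² u_x + (3/8) u⁴ = 0, where subscripts denote partial derivatives in x and t. -/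
/-- The rational function `u(x,t) = 2(9x² + 6c₂x + c₂²)/(3x³ + 3c₂x² + c₂²x + 108t + 3c₀)`. -/
noncomputable def uCubic (c₀ c₂ : ℝ) : ℝ → ℝ → ℝ :=
  fun x t => 2 * (9 * x ^ 2 + 6 * c₂ * x + c₂ ^ 2)
    / (3 * x ^ 3 + 3 * c₂ * x ^ 2 + c₂ ^ 2 * x + 108 * t + 3 * c₀)

theorem px_uCubic {c₀ c₂ x t : ℝ}
    (h : 3 * x ^ 3 + 3 * c₂ * x ^ 2 + c₂ ^ 2 * x + 108 * t + 3 * c₀ ≠ 0) :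
    px (uCubic c₀ c₂) x t =
      (12 * (3 * x + c₂) * (3 * x ^ 3 + 3 * c₂ * x ^ 2 + c₂ ^ 2 * x + 108 * t + 3 * c₀)
          - 2 * (3 * x + c₂) ^ 4)
        / (3 * x ^ 3 + 3 * c₂ * x ^ 2 + c₂ ^ 2 * x + 108 * t + 3 * c₀) ^ 2 := by
  have hx := hasDerivAt_id' x
  have hN := ((((hx.pow 2).const_mul 9).add (hx.const_mul (6 * c₂))).add_const
    (c₂ ^ 2)).const_mul 2
  have hF := (((((hx.pow 3).const_mul 3).add ((hx.pow 2).const_mul (3 * c₂))).add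
    (hx.const_mul (c₂ ^ 2))).add_const (108 * t)).add_const (3 * c₀)
  refine (hN.div hF h).deriv.trans ?_
  simp only [Pi.add_apply, Pi.pow_apply]
  congr 1
  push_cast
  ring

theorem pt_uCubic {c₀ c₂ x t : ℝ}
    (h : 3 * x ^ 3 + 3 * c₂ * x ^ 2 + c₂ ^ 2 * x + 108 * t + 3 * c₀ ≠ 0) :
    pt (uCubic c₀ c₂) x t =
      -(216 * (3 * x + c₂) ^ 2)
        / (3 * x ^ 3 + 3 * c₂ * x ^ 2 + c₂ ^ 2 * x + 108 * t + 3 * c₀) ^ 2 := by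
  have hN := hasDerivAt_const t (2 * (9 * x ^ 2 + 6 * c₂ * x + c₂ ^ 2))
  have hF := (((hasDerivAt_id' t).const_mul 108).const_add
    (3 * x ^ 3 + 3 * c₂ * x ^ 2 + c₂ ^ 2 * x)).add_const (3 * c₀)
  refine (hN.div hF h).deriv.trans ?_
  congr 1
  ring

/-- The rational function `uCubic` satisfies the KdV-like equation
`u_t + (3/2) u_x² + (3/2) u² u_x + (3/8) u⁴ = 0` on the open set where its denominator
does not vanish. -/
theorem uCubic_solves_KdV_like (c₀ c₂ : ℝ) :
    ∀ x t : ℝ, 3 * x ^ 3 + 3 * c₂ * x ^ 2 + c₂ ^ 2 * x + 108 * t + 3 * c₀ ≠ 0 →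
      pt (uCubic c₀ c₂) x t
        + (3 / 2) * (px (uCubic c₀ c₂) x t) ^ 2
        + (3 / 2) * (uCubic c₀ c₂ x t) ^ 2 * px (uCubic c₀ c₂) x t
        + (3 / 8) * (uCubic c₀ c₂ x t) ^ 4 = 0 := by
  intro x t h
  rw [px_uCubic h, pt_uCubic h, uCubic]
  field_simp
  ring
end

section
/- Let c₁, c₂, c₃ ∈ ℝ and define u(x,t) = 2(48x³ + 36c₃x² + 24c₂x + 1728t + 12c₁)/(12x⁴ + 12c₃x³ + 12c₂x² + 1728tx + 12c₁x + 432c₃t + 3c₁c₃ − c₂²) on the open set D = {(x,t) ∈ ℝ² : 12x⁴ + 12c₃x³ + 12c₂x² + 1728tx + 12c₁x + 432c₃t + 3c₁c₃ − c₂² ≠ 0}. Then u is a rational solution of the KdV-like equation: at every point of D, u_t + (3/2)(u_x)² + (3/2) u² u_x + (3/8) u⁴ = 0, where subscripts denote partial derivatives in x and t. -/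
/-- The rational function
`u(x,t) = 2(48x³ + 36c₃x² + 24c₂x + 1728t + 12c₁)
  / (12x⁴ + 12c₃x³ + 12c₂x² + 1728tx + 12c₁x + 432c₃t + 3c₁c₃ − c₂²)`. -/
noncomputable def uQuartic (c₁ c₂ c₃ : ℝ) : ℝ → ℝ → ℝ :=
  fun x t => 2 * (48 * x ^ 3 + 36 * c₃ * x ^ 2 + 24 * c₂ * x + 1728 * t + 12 * c₁)
    / (12 * x ^ 4 + 12 * c₃ * x ^ 3 + 12 * c₂ * x ^ 2 + 1728 * t * x + 12 * c₁ * x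
        + 432 * c₃ * t + 3 * c₁ * c₃ - c₂ ^ 2)

/-- The polynomial whose logarithmic `x`-derivative, doubled, is `uQuartic`. -/
def tauQuartic (c₁ c₂ c₃ x t : ℝ) : ℝ :=
  12 * x ^ 4 + 12 * c₃ * x ^ 3 + 12 * c₂ * x ^ 2 + 1728 * t * x + 12 * c₁ * x
    + 432 * c₃ * t + 3 * c₁ * c₃ - c₂ ^ 2

/-- The `x`-derivative of `tauQuartic`. -/
def tauQuarticX (c₁ c₂ c₃ x t : ℝ) : ℝ :=
  48 * x ^ 3 + 36 * c₃ * x ^ 2 + 24 * c₂ * x + 1728 * t + 12 * c₁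

/-- The second `x`-derivative of `tauQuartic`. -/
def tauQuarticXX (c₂ c₃ x : ℝ) : ℝ :=
  144 * x ^ 2 + 72 * c₃ * x + 24 * c₂

theorem uQuartic_eq (c₁ c₂ c₃ x t : ℝ) :
    uQuartic c₁ c₂ c₃ x t = 2 * tauQuarticX c₁ c₂ c₃ x t / tauQuartic c₁ c₂ c₃ x t :=
  rfl

theorem hasDerivAt_tauQuartic_space (c₁ c₂ c₃ x t : ℝ) :
    HasDerivAt (fun y => tauQuartic c₁ c₂ c₃ y t) (tauQuarticX c₁ c₂ c₃ x t) x := by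
  have h := (((((((hasDerivAt_pow 4 x).const_mul 12).add
    ((hasDerivAt_pow 3 x).const_mul (12 * c₃))).add
    ((hasDerivAt_pow 2 x).const_mul (12 * c₂))).add
    ((hasDerivAt_id' x).const_mul (1728 * t))).add
    ((hasDerivAt_id' x).const_mul (12 * c₁))).add_const (432 * c₃ * t)).add_const
    (3 * c₁ * c₃) |>.sub_const (c₂ ^ 2)
  refine h.congr_deriv ?_
  simp only [tauQuarticX]
  norm_num
  ring

theorem hasDerivAt_tauQuarticX_space (c₁ c₂ c₃ x t : ℝ) :
    HasDerivAt (fun y => tauQuarticX c₁ c₂ c₃ y t) (tauQuarticXX c₂ c₃ x) x := by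
  have h := (((((hasDerivAt_pow 3 x).const_mul 48).add
    ((hasDerivAt_pow 2 x).const_mul (36 * c₃))).add
    ((hasDerivAt_id' x).const_mul (24 * c₂))).add_const (1728 * t)).add_const (12 * c₁)
  refine h.congr_deriv ?_
  simp only [tauQuarticXX]
  norm_num
  ring

theorem hasDerivAt_tauQuartic_time (c₁ c₂ c₃ x t : ℝ) :
    HasDerivAt (fun s => tauQuartic c₁ c₂ c₃ x s) (1728 * x + 432 * c₃) t := by
  have affine : (fun s => tauQuartic c₁ c₂ c₃ x s) =
      fun s => (1728 * x + 432 * c₃) * s + tauQuartic c₁ c₂ c₃ x 0 := by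
    funext s
    simp only [tauQuartic]
    ring
  rw [affine]
  simpa using ((hasDerivAt_id' t).const_mul (1728 * x + 432 * c₃)).add_const
    (tauQuartic c₁ c₂ c₃ x 0)

theorem hasDerivAt_tauQuarticX_time (c₁ c₂ c₃ x t : ℝ) :
    HasDerivAt (fun s => tauQuarticX c₁ c₂ c₃ x s) 1728 t := by
  have affine : (fun s => tauQuarticX c₁ c₂ c₃ x s) =
      fun s => 1728 * s + tauQuarticX c₁ c₂ c₃ x 0 := by
    funext s
    simp only [tauQuarticX]
    ring
  rw [affine]
  simpa using ((hasDerivAt_id' t).const_mul 1728).add_const (tauQuarticX c₁ c₂ c₃ x 0)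

/-- `tauQuartic` solves the generalized bilinear KdV-type equation. -/
theorem tauQuartic_bilinear (c₁ c₂ c₃ x t : ℝ) :
    2 * 1728 * tauQuartic c₁ c₂ c₃ x t
      - 2 * (1728 * x + 432 * c₃) * tauQuarticX c₁ c₂ c₃ x t
      + 6 * tauQuarticXX c₂ c₃ x ^ 2 = 0 := by
  simp only [tauQuartic, tauQuarticX, tauQuarticXX]
  ring

theorem px_uQuartic {c₁ c₂ c₃ x t : ℝ} (h : tauQuartic c₁ c₂ c₃ x t ≠ 0) :
    px (uQuartic c₁ c₂ c₃) x t =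
      (2 * tauQuarticXX c₂ c₃ x * tauQuartic c₁ c₂ c₃ x t
        - 2 * tauQuarticX c₁ c₂ c₃ x t * tauQuarticX c₁ c₂ c₃ x t)
        / tauQuartic c₁ c₂ c₃ x t ^ 2 :=
  (((hasDerivAt_tauQuarticX_space c₁ c₂ c₃ x t).const_mul 2).div
    (hasDerivAt_tauQuartic_space c₁ c₂ c₃ x t) h).deriv

theorem pt_uQuartic {c₁ c₂ c₃ x t : ℝ} (h : tauQuartic c₁ c₂ c₃ x t ≠ 0) :
    pt (uQuartic c₁ c₂ c₃) x t =
      (2 * 1728 * tauQuartic c₁ c₂ c₃ x t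
        - 2 * tauQuarticX c₁ c₂ c₃ x t * (1728 * x + 432 * c₃))
        / tauQuartic c₁ c₂ c₃ x t ^ 2 :=
  (((hasDerivAt_tauQuarticX_time c₁ c₂ c₃ x t).const_mul 2).div
    (hasDerivAt_tauQuartic_time c₁ c₂ c₃ x t) h).deriv

/-- The rational function `uQuartic` satisfies the KdV-like equation
`u_t + (3/2) u_x² + (3/2) u² u_x + (3/8) u⁴ = 0` on the open set where its denominator
does not vanish. -/
theorem uQuartic_solves_KdV_like (c₁ c₂ c₃ : ℝ) :
    ∀ x t : ℝ,
      12 * x ^ 4 + 12 * c₃ * x ^ 3 + 12 * c₂ * x ^ 2 + 1728 * t * x + 12 * c₁ * x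
        + 432 * c₃ * t + 3 * c₁ * c₃ - c₂ ^ 2 ≠ 0 →
      pt (uQuartic c₁ c₂ c₃) x t
        + (3 / 2) * (px (uQuartic c₁ c₂ c₃) x t) ^ 2
        + (3 / 2) * (uQuartic c₁ c₂ c₃ x t) ^ 2 * px (uQuartic c₁ c₂ c₃) x t
        + (3 / 8) * (uQuartic c₁ c₂ c₃ x t) ^ 4 = 0 := by
  intro x t h
  change tauQuartic c₁ c₂ c₃ x t ≠ 0 at h
  rw [pt_uQuartic h, px_uQuartic h, uQuartic_eq]
  have key := tauQuartic_bilinear c₁ c₂ c₃ x t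
  generalize tauQuartic c₁ c₂ c₃ x t = f at *
  generalize tauQuarticX c₁ c₂ c₃ x t = g at *
  generalize tauQuarticXX c₂ c₃ x = k at *
  calc
    _ = (2 * 1728 * f - 2 * (1728 * x + 432 * c₃) * g + 6 * k ^ 2) / f ^ 2 := by
      field_simp
      ring
    _ = 0 := by rw [key, zero_div]
end
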